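/- arXiv:2512.21689 — 4 statements merged into one kernel-verified Lean document; each statement's English description precedes it below -/
import Mathlib

section
/- Let β* ∈ ℝ^{d_t} and θ* ∈ ℝ^{d_s}, and define B = {(j,l) : β*_j = θ*_l}, A_t = {j : β*_j ≠ 0}, A_s = {l : θ*_l ≠ 0}, T_t = {j ∈ A_t : ∃ l ∈ A_s, β*_j = θ*_l}, T_s = {l ∈ A_s : ∃ j ∈ A_t, θ*_l = β*_j}, I_t = A_t \ T_t, I_s = A_s \ T_s, the canonical representative set T̃_t (the smallest index in T_t attaining each distinct shared value), the distinct shared values α*_1,…,α*_m (m = |T̃_t|), and binary matching matrices M^(t) ∈ {0,1}^{|T_t|×m}, M^(s) ∈ {0,1}^{|T_s|×m} with [M^(t)]_{i,r} = 1{β*_{j_i} = α*_r} and [M^(s)]_{i,r} = 1{θ*_{l_i} = α*_r}, where j_i and l_i are the i-th smallest indices of T_t and T_s. Assume A_t^c ≠ ∅. Then a pair (β, θ) ∈ ℝ^{d_t} × ℝ^{d_s} satisfies the constraints β_{A_t^c} = 0 and β_j = θ_l for all (j,l) ∈ B if and only if there exists a vector v ∈ ℝ^m such that β_{A_t^c}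 = 0, θ_{A_s^c} = 0, β_{T_t} = M^(t) v, θ_{T_s} = M^(s) v, with β_{I_t} and θ_{I_s} arbitrary; in that case necessarily v = β_{T̃_t}. -/
/-!
Statement 0: reconstruction of the oracle constraints via the canonical
representative set `T̃_t` and the matching matrices `M^(t)`, `M^(s)`.
-/

open scoped Classical

noncomputable section

namespace CSTL0

variable {dt ds : ℕ}

/-- Target transferable set `T_t = {j ∈ A_t : ∃ l ∈ A_s, β*_j = θ*_l}`. -/
def TtSet (βs : Fin dt → ℝ) (θs : Fin ds → ℝ) : Set (Fin dt) :=
  {j | βs j ≠ 0 ∧ ∃ l, θs l ≠ 0 ∧ βs j = θs l}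

/-- Source transferable set `T_s = {l ∈ A_s : ∃ j ∈ A_t, θ*_l = β*_j}`. -/
def TsSet (βs : Fin dt → ℝ) (θs : Fin ds → ℝ) : Set (Fin ds) :=
  {l | θs l ≠ 0 ∧ ∃ j, βs j ≠ 0 ∧ θs l = βs j}

/-- Canonical representative set `T̃_t`: the smallest index of `T_t`
attaining each distinct shared value. -/
def TtilSet (βs : Fin dt → ℝ) (θs : Fin ds → ℝ) : Set (Fin dt) :=
  {j | j ∈ TtSet βs θs ∧ ∀ j' ∈ TtSet βs θs, βs j' = βs j → j ≤ j'}

/-- Target matching matrix `M^(t)`, with rows indexed by `T_t` and columns by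
`T̃_t` (the distinct shared values `α*_r = β*_r`, `r ∈ T̃_t`):
`[M^(t)]_{j,r} = 1{β*_j = α*_r}`. -/
def Mt (βs : Fin dt → ℝ) (θs : Fin ds → ℝ)
    (j : {j // j ∈ TtSet βs θs}) (r : {r // r ∈ TtilSet βs θs}) : ℝ :=
  if βs j.1 = βs r.1 then 1 else 0

/-- Source matching matrix `M^(s)`: `[M^(s)]_{l,r} = 1{θ*_l = α*_r}`. -/
def Ms (βs : Fin dt → ℝ) (θs : Fin ds → ℝ)
    (l : {l // l ∈ TsSet βs θs}) (r : {r // r ∈ TtilSet βs θs}) : ℝ :=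
  if θs l.1 = βs r.1 then 1 else 0

/-- Every shared value is attained by a canonical representative. -/
lemma exists_rep (βs : Fin dt → ℝ) (θs : Fin ds → ℝ) {j : Fin dt} (hj : j ∈ TtSet βs θs) :
    ∃ r : {r // r ∈ TtilSet βs θs}, βs j = βs r.1 := by
  obtain ⟨r, ⟨hr, hrj⟩, hmin⟩ := WellFounded.has_min (wellFounded_lt (α := Fin dt))
    {k | k ∈ TtSet βs θs ∧ βs k = βs j} ⟨j, hj, rfl⟩
  exact ⟨⟨r, hr, fun k hk hkr => not_lt.mp (hmin k ⟨hk, hkr.trans hrj⟩)⟩, hrj.symm⟩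

/-- Distinct canonical representatives carry distinct shared values. -/
lemma rep_injective (βs : Fin dt → ℝ) (θs : Fin ds → ℝ) {r r' : {r // r ∈ TtilSet βs θs}}
    (h : βs r.1 = βs r'.1) : r = r' :=
  Subtype.ext (le_antisymm (r.2.2 _ r'.2.1 h.symm) (r'.2.2 _ r.2.1 h))

/-- A row of a matching matrix selects the entry of its representative. -/
lemma sum_indicator_mul (βs : Fin dt → ℝ) (θs : Fin ds → ℝ) {c : ℝ}
    (r : {r // r ∈ TtilSet βs θs}) (hc : c = βs r.1) (v : {r // r ∈ TtilSet βs θs} → ℝ) :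
    ∑ r', (if c = βs r'.1 then (1 : ℝ) else 0) * v r' = v r := by
  rw [Finset.sum_eq_single r]
  · simp [hc]
  · intro r' _ hne
    rw [if_neg fun h => hne (rep_injective βs θs (h.symm.trans hc)), zero_mul]
  · simp

/-- A pair `(β, θ)` satisfies the oracle constraints `β_{A_t^c} = 0` and
`β_j = θ_l` for all `(j,l) ∈ B = {(j,l) : β*_j = θ*_l}` (assuming `A_t^c ≠ ∅`)
iff there is `v ∈ ℝ^m` with `β_{A_t^c} = 0`, `θ_{A_s^c} = 0`,
`β_{T_t} = M^(t) v`, `θ_{T_s} = M^(s) v` (and `β_{I_t}`, `θ_{I_s}` arbitrary);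
moreover necessarily `v = β_{T̃_t}`. -/
theorem oracle_constraint_reconstruction
    (βs : Fin dt → ℝ) (θs : Fin ds → ℝ)
    (hAtc : ∃ j, βs j = 0)
    (β : Fin dt → ℝ) (θ : Fin ds → ℝ) :
    (((∀ j, βs j = 0 → β j = 0) ∧ ∀ j l, βs j = θs l → β j = θ l) ↔
      ∃ v : {r // r ∈ TtilSet βs θs} → ℝ,
        (∀ j, βs j = 0 → β j = 0) ∧
        (∀ l, θs l = 0 → θ l = 0) ∧
        (∀ j : {j // j ∈ TtSet βs θs}, β j.1 = ∑ r, Mt βs θs j r * v r) ∧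
        (∀ l : {l // l ∈ TsSet βs θs}, θ l.1 = ∑ r, Ms βs θs l r * v r)) ∧
    (∀ v : {r // r ∈ TtilSet βs θs} → ℝ,
      ((∀ j, βs j = 0 → β j = 0) ∧
        (∀ l, θs l = 0 → θ l = 0) ∧
        (∀ j : {j // j ∈ TtSet βs θs}, β j.1 = ∑ r, Mt βs θs j r * v r) ∧
        (∀ l : {l // l ∈ TsSet βs θs}, θ l.1 = ∑ r, Ms βs θs l r * v r)) →
      ∀ r : {r // r ∈ TtilSet βs θs}, v r = β r.1) := by
  refine ⟨⟨?_, ?_⟩, ?_⟩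
  · rintro ⟨hβ, hB⟩
    refine ⟨fun r => β r.1, hβ, fun l hl => ?_, fun j => ?_, fun l => ?_⟩
    · obtain ⟨j, hj⟩ := hAtc
      rw [← hB j l (hj.trans hl.symm), hβ j hj]
    · obtain ⟨r, hr⟩ := exists_rep βs θs j.2
      refine Eq.trans ?_ (sum_indicator_mul βs θs r hr _).symm
      obtain ⟨-, l, -, hl⟩ := j.2
      rw [hB _ l hl, hB _ l (hr.symm.trans hl)]
    · obtain ⟨hl, j, hj, hlj⟩ := l.2
      obtain ⟨r, hr⟩ := exists_rep βs θs (j := j) ⟨hj, l.1, hl, hlj.symm⟩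
      refine Eq.trans ?_ (sum_indicator_mul βs θs r (hlj.trans hr) _).symm
      exact (hB _ _ (hr.symm.trans hlj.symm)).symm
  · rintro ⟨v, hβ, hθ, ht, hs⟩
    refine ⟨hβ, fun j l hjl => ?_⟩
    by_cases hj : βs j = 0
    · rw [hβ j hj, hθ l (hjl.symm.trans hj)]
    · have hl : θs l ≠ 0 := hjl ▸ hj
      have hjT : j ∈ TtSet βs θs := ⟨hj, l, hl, hjl⟩
      obtain ⟨r, hr⟩ := exists_rep βs θs hjT
      exact ((ht ⟨j, hjT⟩).trans (sum_indicator_mul βs θs r hr v)).trans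
        ((hs ⟨l, hl, j, hj, hjl.symm⟩).trans
          (sum_indicator_mul βs θs r (hjl.symm.trans hr) v)).symm
  · rintro v ⟨-, -, ht, -⟩ r
    exact ((ht ⟨r.1, r.2.1⟩).trans (sum_indicator_mul βs θs r rfl v)).symm

end CSTL0
end
end

section
/- Consider the constrained least-squares (oracle) problem: minimize over (β, θ) ∈ ℝ^{d_t} × ℝ^{d_s} the objective (1/n_t)‖Y^(t) − X^(t)β‖₂² + (1/n_s)‖Y^(s) − X^(s)θ‖₂² subject to β_{A_t^c} = 0 and β_j = θ_l for all (j,l) ∈ B. Assume A_t^c ≠ ∅, that X^(t)_{I_t} and X^(s)_{I_s} have full column rank, and that the pooled projected design X̃_{T̃_t} = (n_t^{-1/2}(I − P^(t)_{I_t}) X̃^(t)_{T̃_t}; n_s^{-1/2}(I − P^(s)_{I_s}) X̃^(s)_{T̃_t}) has full column rank. Then the problem has a unique minimizer (β̂_ora, θ̂_ora), and its canonical transferable component satisfies β̂_{ora, T̃_t} = [(X̃_{T̃_t})ᵀ X̃_{T̃_t}]⁻¹ (X̃_{T̃_t})ᵀ Y, where Y = (n_t^{-1/2} Y^(t); n_s^{-1/2}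 Y^(s)). -/
/-! Statement 2: closed form of the transferable component of the unique oracle minimizer. -/
open Matrix
open scoped Classical

noncomputable section

namespace CSTL2

variable {nt ns dt ds : ℕ}

/-- Target transferable set `T_t`. -/
def TtSet (βs : Fin dt → ℝ) (θs : Fin ds → ℝ) : Set (Fin dt) :=
  {j | βs j ≠ 0 ∧ ∃ l, θs l ≠ 0 ∧ βs j = θs l}

/-- Source transferable set `T_s`. -/
def TsSet (βs : Fin dt → ℝ) (θs : Fin ds → ℝ) : Set (Fin ds) :=
  {l | θs l ≠ 0 ∧ ∃ j, βs j ≠ 0 ∧ θs l = βs j}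

/-- Canonical representative set `T̃_t`. -/
def TtilSet (βs : Fin dt → ℝ) (θs : Fin ds → ℝ) : Set (Fin dt) :=
  {j | j ∈ TtSet βs θs ∧ ∀ j' ∈ TtSet βs θs, βs j' = βs j → j ≤ j'}

/-- Target-specific set `I_t = A_t \ T_t`. -/
def ItSet (βs : Fin dt → ℝ) (θs : Fin ds → ℝ) : Set (Fin dt) :=
  {j | βs j ≠ 0} \ TtSet βs θs

/-- Source-specific set `I_s = A_s \ T_s`. -/
def IsSet (βs : Fin dt → ℝ) (θs : Fin ds → ℝ) : Set (Fin ds) :=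
  {l | θs l ≠ 0} \ TsSet βs θs

/-- Target matching matrix `M^(t)`. -/
def Mmt (βs : Fin dt → ℝ) (θs : Fin ds → ℝ) :
    Matrix {j // j ∈ TtSet βs θs} {r // r ∈ TtilSet βs θs} ℝ :=
  Matrix.of fun j r => if βs j.1 = βs r.1 then 1 else 0

/-- Source matching matrix `M^(s)`. -/
def Mms (βs : Fin dt → ℝ) (θs : Fin ds → ℝ) :
    Matrix {l // l ∈ TsSet βs θs} {r // r ∈ TtilSet βs θs} ℝ :=
  Matrix.of fun l r => if θs l.1 = βs r.1 then 1 else 0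

/-- Column submatrix `X_S`. -/
def colsub {n d : ℕ} (X : Matrix (Fin n) (Fin d) ℝ) (S : Set (Fin d)) :
    Matrix (Fin n) {j // j ∈ S} ℝ :=
  X.submatrix id Subtype.val

/-- Projection matrix `P_S = X_S [(X_S)ᵀ X_S]⁻¹ (X_S)ᵀ`. -/
def proj {n d : ℕ} (X : Matrix (Fin n) (Fin d) ℝ) (S : Set (Fin d)) :
    Matrix (Fin n) (Fin n) ℝ :=
  colsub X S * ((colsub X S)ᵀ * colsub X S)⁻¹ * (colsub X S)ᵀ

/-- Merged transferable target design `X̃^(t)_{T̃_t} = X^(t)_{T_t} M^(t)`. -/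
def XtilT (Xt : Matrix (Fin nt) (Fin dt) ℝ) (βs : Fin dt → ℝ) (θs : Fin ds → ℝ) :
    Matrix (Fin nt) {r // r ∈ TtilSet βs θs} ℝ :=
  colsub Xt (TtSet βs θs) * Mmt βs θs

/-- Merged transferable source design `X̃^(s)_{T̃_t} = X^(s)_{T_s} M^(s)`. -/
def XtilS (Xs : Matrix (Fin ns) (Fin ds) ℝ) (βs : Fin dt → ℝ) (θs : Fin ds → ℝ) :
    Matrix (Fin ns) {r // r ∈ TtilSet βs θs} ℝ :=
  colsub Xs (TsSet βs θs) * Mms βs θs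

/-- Pooled projected design `X̃_{T̃_t}`. -/
def Xpool (Xt : Matrix (Fin nt) (Fin dt) ℝ) (Xs : Matrix (Fin ns) (Fin ds) ℝ)
    (βs : Fin dt → ℝ) (θs : Fin ds → ℝ) :
    Matrix (Fin nt ⊕ Fin ns) {r // r ∈ TtilSet βs θs} ℝ :=
  Matrix.fromRows
    ((Real.sqrt nt)⁻¹ • ((1 - proj Xt (ItSet βs θs)) * XtilT Xt βs θs))
    ((Real.sqrt ns)⁻¹ • ((1 - proj Xs (IsSet βs θs)) * XtilS Xs βs θs))

/-- Pooled response `Y`. -/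
def Ypool (Yt : Fin nt → ℝ) (Ys : Fin ns → ℝ) : (Fin nt ⊕ Fin ns) → ℝ :=
  Sum.elim ((Real.sqrt nt)⁻¹ • Yt) ((Real.sqrt ns)⁻¹ • Ys)

/-- Feasibility for the oracle problem: `β_{A_t^c} = 0` and `β_j = θ_l`
for all `(j,l) ∈ B = {(j,l) : β*_j = θ*_l}`. -/
def feas (βs : Fin dt → ℝ) (θs : Fin ds → ℝ)
    (p : (Fin dt → ℝ) × (Fin ds → ℝ)) : Prop :=
  (∀ j, βs j = 0 → p.1 j = 0) ∧ ∀ j l, βs j = θs l → p.1 j = p.2 l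

/-- The two-domain least-squares objective. -/
def obj (Xt : Matrix (Fin nt) (Fin dt) ℝ) (Yt : Fin nt → ℝ)
    (Xs : Matrix (Fin ns) (Fin ds) ℝ) (Ys : Fin ns → ℝ)
    (p : (Fin dt → ℝ) × (Fin ds → ℝ)) : ℝ :=
  (nt : ℝ)⁻¹ * ∑ i, (Yt i - (Xt *ᵥ p.1) i) ^ 2 +
    (ns : ℝ)⁻¹ * ∑ i, (Ys i - (Xs *ᵥ p.2) i) ^ 2

/-- A minimizer of the constrained (oracle) least-squares problem. -/
def isOracleMin (Xt : Matrix (Fin nt) (Fin dt) ℝ) (Yt : Fin nt → ℝ)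
    (Xs : Matrix (Fin ns) (Fin ds) ℝ) (Ys : Fin ns → ℝ)
    (βs : Fin dt → ℝ) (θs : Fin ds → ℝ)
    (p : (Fin dt → ℝ) × (Fin ds → ℝ)) : Prop :=
  feas βs θs p ∧ ∀ q, feas βs θs q → obj Xt Yt Xs Ys p ≤ obj Xt Yt Xs Ys q

/-- Closed-form expression `[(X̃_{T̃_t})ᵀ X̃_{T̃_t}]⁻¹ (X̃_{T̃_t})ᵀ Y`. -/
def betaHatTtil (Xt : Matrix (Fin nt) (Fin dt) ℝ) (Yt : Fin nt → ℝ)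
    (Xs : Matrix (Fin ns) (Fin ds) ℝ) (Ys : Fin ns → ℝ)
    (βs : Fin dt → ℝ) (θs : Fin ds → ℝ) : {r // r ∈ TtilSet βs θs} → ℝ :=
  ((Xpool Xt Xs βs θs)ᵀ * Xpool Xt Xs βs θs)⁻¹ *ᵥ
    ((Xpool Xt Xs βs θs)ᵀ *ᵥ Ypool Yt Ys)

/-- Least-squares coefficients of `y` on the columns of `A`. -/
def lsCoef {m k : Type*} [Fintype m] [Fintype k] [DecidableEq k]
    (A : Matrix m k ℝ) (y : m → ℝ) : k → ℝ :=
  (Aᵀ * A)⁻¹ *ᵥ (Aᵀ *ᵥ y)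

theorem mulVec_dotProduct_self_nonneg {m k : Type*} [Fintype m] [Fintype k]
    (A : Matrix m k ℝ) (v : k → ℝ) :
    0 ≤ (A *ᵥ v) ⬝ᵥ (A *ᵥ v) :=
  Finset.sum_nonneg fun _ _ => mul_self_nonneg _

section LeastSquares

variable {m k : Type*} [Fintype m] [Fintype k] [DecidableEq k]

theorem transpose_mulVec_residual (A : Matrix m k ℝ) (hA : IsUnit (Aᵀ * A).det) (y : m → ℝ) :
    Aᵀ *ᵥ (y - A *ᵥ lsCoef A y) = 0 := by
  rw [mulVec_sub, lsCoef, mulVec_mulVec, mulVec_mulVec, mul_nonsing_inv _ hA, one_mulVec, sub_self]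

theorem residual_pythagoras (A : Matrix m k ℝ) (hA : IsUnit (Aᵀ * A).det)
    (y : m → ℝ) (a : k → ℝ) :
    (y - A *ᵥ a) ⬝ᵥ (y - A *ᵥ a) =
      (y - A *ᵥ lsCoef A y) ⬝ᵥ (y - A *ᵥ lsCoef A y) +
        (A *ᵥ (a - lsCoef A y)) ⬝ᵥ (A *ᵥ (a - lsCoef A y)) := by
  have horth : (A *ᵥ (a - lsCoef A y)) ⬝ᵥ (y - A *ᵥ lsCoef A y) = 0 := by
    rw [dotProduct_comm, dotProduct_mulVec, ← mulVec_transpose, transpose_mulVec_residual A hA,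
      zero_dotProduct]
  have hsplit : y - A *ᵥ a = (y - A *ᵥ lsCoef A y) - A *ᵥ (a - lsCoef A y) := by
    rw [mulVec_sub]; abel
  rw [hsplit]
  generalize y - A *ᵥ lsCoef A y = u at horth ⊢
  generalize A *ᵥ (a - lsCoef A y) = v at horth ⊢
  rw [sub_dotProduct, dotProduct_sub, dotProduct_sub, dotProduct_comm u v, horth]
  ring

theorem eq_zero_of_mulVec_dotProduct_self_eq_zero (A : Matrix m k ℝ)
    (hA : IsUnit (Aᵀ * A).det) {v : k → ℝ} (h : (A *ᵥ v) ⬝ᵥ (A *ᵥ v) = 0) : v = 0 := by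
  have hv : (Aᵀ * A) *ᵥ v = 0 := by
    rw [← mulVec_mulVec, dotProduct_self_eq_zero.mp h, mulVec_zero]
  have := congrArg ((Aᵀ * A)⁻¹ *ᵥ ·) hv
  simpa [mulVec_mulVec, nonsing_inv_mul _ hA] using this

end LeastSquares

section Projection

variable {n d : ℕ} (X : Matrix (Fin n) (Fin d) ℝ) (S : Set (Fin d))

theorem colsub_mulVec_lsCoef (y : Fin n → ℝ) :
    colsub X S *ᵥ lsCoef (colsub X S) y = proj X S *ᵥ y := by
  simp only [lsCoef, proj, mulVec_mulVec, Matrix.mul_assoc]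

theorem one_sub_proj_transpose : (1 - proj X S)ᵀ = 1 - proj X S := by
  simp [proj, transpose_mul, transpose_nonsing_inv, Matrix.mul_assoc]

theorem proj_mul_self (h : IsUnit ((colsub X S)ᵀ * colsub X S).det) :
    proj X S * proj X S = proj X S := by
  have := nonsing_inv_mul _ h
  calc proj X S * proj X S
      = colsub X S * ((((colsub X S)ᵀ * colsub X S)⁻¹ * ((colsub X S)ᵀ * colsub X S)) *
          ((colsub X S)ᵀ * colsub X S)⁻¹) * (colsub X S)ᵀ := by
        simp only [proj, Matrix.mul_assoc]
    _ = proj X S := by rw [this, Matrix.one_mul, proj]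

theorem one_sub_proj_mul_self (h : IsUnit ((colsub X S)ᵀ * colsub X S).det) :
    (1 - proj X S) * (1 - proj X S) = 1 - proj X S := by
  rw [Matrix.sub_mul, Matrix.mul_sub, Matrix.mul_sub, proj_mul_self X S h]
  simp

theorem transpose_one_sub_proj_mulVec (h : IsUnit ((colsub X S)ᵀ * colsub X S).det)
    {k : Type*} (Z : Matrix (Fin n) k ℝ) (y : Fin n → ℝ) :
    ((1 - proj X S) * Z)ᵀ *ᵥ ((1 - proj X S) *ᵥ y) = ((1 - proj X S) * Z)ᵀ *ᵥ y := by
  rw [transpose_mul, one_sub_proj_transpose, mulVec_mulVec, Matrix.mul_assoc,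
    one_sub_proj_mul_self X S h]

theorem profile_residual (h : IsUnit ((colsub X S)ᵀ * colsub X S).det)
    {k : Type*} [Fintype k] (Z : Matrix (Fin n) k ℝ) (y : Fin n → ℝ) (b : k → ℝ)
    (a : {j // j ∈ S} → ℝ) :
    (y - (Z *ᵥ b + colsub X S *ᵥ a)) ⬝ᵥ (y - (Z *ᵥ b + colsub X S *ᵥ a)) =
      ((1 - proj X S) *ᵥ y - ((1 - proj X S) * Z) *ᵥ b) ⬝ᵥ
          ((1 - proj X S) *ᵥ y - ((1 - proj X S) * Z) *ᵥ b) +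
        (colsub X S *ᵥ (a - lsCoef (colsub X S) (y - Z *ᵥ b))) ⬝ᵥ
          (colsub X S *ᵥ (a - lsCoef (colsub X S) (y - Z *ᵥ b))) := by
  have hres : (1 - proj X S) *ᵥ y - ((1 - proj X S) * Z) *ᵥ b =
      (y - Z *ᵥ b) - colsub X S *ᵥ lsCoef (colsub X S) (y - Z *ᵥ b) := by
    rw [colsub_mulVec_lsCoef, ← mulVec_mulVec, ← mulVec_sub, sub_mulVec, one_mulVec]
  rw [hres, ← sub_sub]
  exact residual_pythagoras _ h _ _

end Projection

theorem mulVec_eq_colsub_add_colsub {n d : ℕ} (X : Matrix (Fin n) (Fin d) ℝ)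
    {S T : Set (Fin d)} (hST : Disjoint S T) (v : Fin d → ℝ)
    (hv : ∀ j, j ∉ S → j ∉ T → v j = 0) :
    X *ᵥ v = colsub X S *ᵥ (fun j => v j.1) + colsub X T *ᵥ (fun j => v j.1) := by
  funext i
  have hsub : ∀ U : Set (Fin d), (colsub X U *ᵥ fun j => v j.1) i =
      ∑ j, if j ∈ U then X i j * v j else 0 := by
    intro U
    rw [← Finset.sum_filter]
    simp only [mulVec, dotProduct, colsub, submatrix_apply, id]
    exact (Finset.sum_subtype _ (by simp) fun j => X i j * v j).symm
  rw [Pi.add_apply, hsub, hsub, ← Finset.sum_add_distrib]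
  simp only [mulVec, dotProduct]
  refine Finset.sum_congr rfl fun j _ => ?_
  by_cases h1 : j ∈ S
  · have h2 : j ∉ T := Set.disjoint_left.mp hST h1
    simp [h1, h2]
  · by_cases h2 : j ∈ T
    · simp [h1, h2]
    · simp [h1, h2, hv j h1 h2]

section Matching

variable (βs : Fin dt → ℝ) (θs : Fin ds → ℝ)

theorem exists_representative {j : Fin dt} (hj : j ∈ TtSet βs θs) :
    ∃ r : {r // r ∈ TtilSet βs θs}, βs j = βs r.1 := by
  obtain ⟨r, hr, hmin⟩ := Set.exists_min_image {i | i ∈ TtSet βs θs ∧ βs i = βs j} id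
    (Set.toFinite _) ⟨j, hj, rfl⟩
  exact ⟨⟨r, hr.1, fun i hi hir => hmin i ⟨hi, hir.trans hr.2⟩⟩, hr.2.symm⟩

theorem representative_injective {r r' : {r // r ∈ TtilSet βs θs}}
    (h : βs r.1 = βs r'.1) : r = r' :=
  Subtype.ext (le_antisymm (r.2.2 _ r'.2.1 h.symm) (r'.2.2 _ r.2.1 h))

theorem sum_representative (b : {r // r ∈ TtilSet βs θs} → ℝ) {x : ℝ}
    {r : {r // r ∈ TtilSet βs θs}} (hr : x = βs r.1) :
    ∑ r' : {r // r ∈ TtilSet βs θs}, (if x = βs r'.1 then 1 else 0) * b r' = b r := by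
  rw [Finset.sum_eq_single r]
  · simp [hr]
  · intro r' _ hne
    rw [if_neg, zero_mul]
    exact fun h => hne (representative_injective βs θs (h.symm.trans hr))
  · simp

theorem Mmt_mulVec (b : {r // r ∈ TtilSet βs θs} → ℝ) (j : {j // j ∈ TtSet βs θs})
    {r : {r // r ∈ TtilSet βs θs}} (hr : βs j.1 = βs r.1) : (Mmt βs θs *ᵥ b) j = b r :=
  sum_representative βs θs b hr

theorem Mms_mulVec (b : {r // r ∈ TtilSet βs θs} → ℝ) (l : {l // l ∈ TsSet βs θs})
    {r : {r // r ∈ TtilSet βs θs}} (hr : θs l.1 = βs r.1) : (Mms βs θs *ᵥ b) l = b r :=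
  sum_representative βs θs b hr

/-- The feasible point with transferable component `b` and domain-specific components `a`, `c`. -/
def assemble (b : {r // r ∈ TtilSet βs θs} → ℝ) (a : {j // j ∈ ItSet βs θs} → ℝ)
    (c : {l // l ∈ IsSet βs θs} → ℝ) : (Fin dt → ℝ) × (Fin ds → ℝ) :=
  (fun j => if h : j ∈ TtSet βs θs then (Mmt βs θs *ᵥ b) ⟨j, h⟩
      else if h : j ∈ ItSet βs θs then a ⟨j, h⟩ else 0,
    fun l => if h : l ∈ TsSet βs θs then (Mms βs θs *ᵥ b) ⟨l, h⟩
      else if h : l ∈ IsSet βs θs then c ⟨l, h⟩ else 0)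

theorem feas_assemble (b : {r // r ∈ TtilSet βs θs} → ℝ) (a : {j // j ∈ ItSet βs θs} → ℝ)
    (c : {l // l ∈ IsSet βs θs} → ℝ) : feas βs θs (assemble βs θs b a c) := by
  have hzt : ∀ j, βs j = 0 → (assemble βs θs b a c).1 j = 0 := by
    intro j hj
    have h1 : j ∉ TtSet βs θs := fun h => h.1 hj
    have h2 : j ∉ ItSet βs θs := fun h => h.1 hj
    simp [assemble, h1, h2]
  refine ⟨hzt, fun j l hjl => ?_⟩
  by_cases hj : βs j = 0
  · have hl : θs l = 0 := hjl ▸ hj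
    have h1 : l ∉ TsSet βs θs := fun h => h.1 hl
    have h2 : l ∉ IsSet βs θs := fun h => h.1 hl
    rw [hzt j hj]
    simp [assemble, h1, h2]
  · have hl : θs l ≠ 0 := hjl ▸ hj
    have h1 : j ∈ TtSet βs θs := ⟨hj, l, hl, hjl⟩
    have h2 : l ∈ TsSet βs θs := ⟨hl, j, hj, hjl.symm⟩
    obtain ⟨r, hr⟩ := exists_representative βs θs h1
    simp only [assemble, dif_pos h1, dif_pos h2]
    rw [Mmt_mulVec βs θs b ⟨j, h1⟩ hr, Mms_mulVec βs θs b ⟨l, h2⟩ (hjl.symm.trans hr)]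

theorem assemble_fst_representative (b : {r // r ∈ TtilSet βs θs} → ℝ)
    (a : {j // j ∈ ItSet βs θs} → ℝ) (c : {l // l ∈ IsSet βs θs} → ℝ) :
    (fun r : {r // r ∈ TtilSet βs θs} => (assemble βs θs b a c).1 r.1) = b := by
  funext r
  simp only [assemble, dif_pos r.2.1]
  exact Mmt_mulVec βs θs b ⟨r.1, r.2.1⟩ rfl

theorem assemble_fst_specific (b : {r // r ∈ TtilSet βs θs} → ℝ)
    (a : {j // j ∈ ItSet βs θs} → ℝ) (c : {l // l ∈ IsSet βs θs} → ℝ) :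
    (fun j : {j // j ∈ ItSet βs θs} => (assemble βs θs b a c).1 j.1) = a := by
  funext j
  simp only [assemble, dif_neg j.2.2, dif_pos j.2]

theorem assemble_snd_specific (b : {r // r ∈ TtilSet βs θs} → ℝ)
    (a : {j // j ∈ ItSet βs θs} → ℝ) (c : {l // l ∈ IsSet βs θs} → ℝ) :
    (fun l : {l // l ∈ IsSet βs θs} => (assemble βs θs b a c).2 l.1) = c := by
  funext l
  simp only [assemble, dif_neg l.2.2, dif_pos l.2]

variable {βs θs} {p : (Fin dt → ℝ) × (Fin ds → ℝ)}

theorem feas.snd_eq_zero (hp : feas βs θs p) (h0 : ∃ j, βs j = 0) {l : Fin ds}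
    (hl : θs l = 0) : p.2 l = 0 := by
  obtain ⟨j, hj⟩ := h0
  rw [← hp.2 j l (hj.trans hl.symm), hp.1 j hj]

theorem feas.fst_transferable (hp : feas βs θs p) :
    (fun j : {j // j ∈ TtSet βs θs} => p.1 j.1) =
      Mmt βs θs *ᵥ fun r : {r // r ∈ TtilSet βs θs} => p.1 r.1 := by
  funext j
  obtain ⟨r, hr⟩ := exists_representative βs θs j.2
  obtain ⟨-, l, -, hjl⟩ := j.2
  rw [Mmt_mulVec βs θs _ j hr, hp.2 _ l hjl, hp.2 r.1 l (hr.symm.trans hjl)]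

theorem feas.snd_transferable (hp : feas βs θs p) :
    (fun l : {l // l ∈ TsSet βs θs} => p.2 l.1) =
      Mms βs θs *ᵥ fun r : {r // r ∈ TtilSet βs θs} => p.1 r.1 := by
  funext l
  obtain ⟨hl, j, hj, hlj⟩ := l.2
  obtain ⟨r, hr⟩ := exists_representative βs θs (j := j) ⟨hj, l.1, hl, hlj.symm⟩
  rw [Mms_mulVec βs θs _ l (hlj.trans hr), hp.2 r.1 l.1 (hr.symm.trans hlj.symm)]

theorem feas.eq_assemble (hp : feas βs θs p) (h0 : ∃ j, βs j = 0) :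
    p = assemble βs θs (fun r => p.1 r.1) (fun j => p.1 j.1) (fun l => p.2 l.1) := by
  refine Prod.ext (funext fun j => ?_) (funext fun l => ?_)
  · by_cases h1 : j ∈ TtSet βs θs
    · simp only [assemble, dif_pos h1, ← hp.fst_transferable]
    · by_cases h2 : j ∈ ItSet βs θs
      · simp only [assemble, dif_neg h1, dif_pos h2]
      · simp only [assemble, dif_neg h1, dif_neg h2]
        exact hp.1 j (by_contra fun h => h2 ⟨h, h1⟩)
  · by_cases h1 : l ∈ TsSet βs θs
    · simp only [assemble, dif_pos h1, ← hp.snd_transferable]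
    · by_cases h2 : l ∈ IsSet βs θs
      · simp only [assemble, dif_neg h1, dif_pos h2]
      · simp only [assemble, dif_neg h1, dif_neg h2]
        exact hp.snd_eq_zero h0 (by_contra fun h => h2 ⟨h, h1⟩)

theorem feas.mulVec_fst (hp : feas βs θs p) (Xt : Matrix (Fin nt) (Fin dt) ℝ) :
    Xt *ᵥ p.1 = XtilT Xt βs θs *ᵥ (fun r => p.1 r.1) +
      colsub Xt (ItSet βs θs) *ᵥ fun j => p.1 j.1 := by
  rw [mulVec_eq_colsub_add_colsub Xt (S := TtSet βs θs) (T := ItSet βs θs)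
    Set.disjoint_sdiff_right p.1 fun j h1 h2 => hp.1 j (by_contra fun h => h2 ⟨h, h1⟩),
    hp.fst_transferable, mulVec_mulVec, XtilT]

theorem feas.mulVec_snd (hp : feas βs θs p) (h0 : ∃ j, βs j = 0)
    (Xs : Matrix (Fin ns) (Fin ds) ℝ) :
    Xs *ᵥ p.2 = XtilS Xs βs θs *ᵥ (fun r => p.1 r.1) +
      colsub Xs (IsSet βs θs) *ᵥ fun l => p.2 l.1 := by
  rw [mulVec_eq_colsub_add_colsub Xs (S := TsSet βs θs) (T := IsSet βs θs)
    Set.disjoint_sdiff_right p.2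
    fun l h1 h2 => hp.snd_eq_zero h0 (by_contra fun h => h2 ⟨h, h1⟩),
    hp.snd_transferable, mulVec_mulVec, XtilS]

end Matching

section Pooled

variable (Xt : Matrix (Fin nt) (Fin dt) ℝ) (Yt : Fin nt → ℝ)
  (Xs : Matrix (Fin ns) (Fin ds) ℝ) (Ys : Fin ns → ℝ)
  (βs : Fin dt → ℝ) (θs : Fin ds → ℝ)

/-- Pooled response after projecting out the domain-specific columns. -/
def projYpool : (Fin nt ⊕ Fin ns) → ℝ :=
  Ypool ((1 - proj Xt (ItSet βs θs)) *ᵥ Yt) ((1 - proj Xs (IsSet βs θs)) *ᵥ Ys)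

theorem lsCoef_projYpool
    (hIt : IsUnit ((colsub Xt (ItSet βs θs))ᵀ * colsub Xt (ItSet βs θs)).det)
    (hIs : IsUnit ((colsub Xs (IsSet βs θs))ᵀ * colsub Xs (IsSet βs θs)).det) :
    lsCoef (Xpool Xt Xs βs θs) (projYpool Xt Yt Xs Ys βs θs) =
      betaHatTtil Xt Yt Xs Ys βs θs := by
  rw [lsCoef, betaHatTtil]
  congr 1
  simp only [Xpool, projYpool, Ypool, transpose_fromRows, fromCols_mulVec_sumElim,
    transpose_smul, smul_mulVec, mulVec_smul, transpose_one_sub_proj_mulVec _ _ hIt,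
    transpose_one_sub_proj_mulVec _ _ hIs]

theorem inv_sqrt_mul_self (n : ℕ) : (Real.sqrt n)⁻¹ * (Real.sqrt n)⁻¹ = (n : ℝ)⁻¹ := by
  rw [← mul_inv, Real.mul_self_sqrt n.cast_nonneg]

theorem pooled_residual (b : {r // r ∈ TtilSet βs θs} → ℝ) :
    (projYpool Xt Yt Xs Ys βs θs - Xpool Xt Xs βs θs *ᵥ b) ⬝ᵥ
        (projYpool Xt Yt Xs Ys βs θs - Xpool Xt Xs βs θs *ᵥ b) =
      (nt : ℝ)⁻¹ *
          (((1 - proj Xt (ItSet βs θs)) *ᵥ Yt -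
              ((1 - proj Xt (ItSet βs θs)) * XtilT Xt βs θs) *ᵥ b) ⬝ᵥ
            ((1 - proj Xt (ItSet βs θs)) *ᵥ Yt -
              ((1 - proj Xt (ItSet βs θs)) * XtilT Xt βs θs) *ᵥ b)) +
        (ns : ℝ)⁻¹ *
          (((1 - proj Xs (IsSet βs θs)) *ᵥ Ys -
              ((1 - proj Xs (IsSet βs θs)) * XtilS Xs βs θs) *ᵥ b) ⬝ᵥ
            ((1 - proj Xs (IsSet βs θs)) *ᵥ Ys -
              ((1 - proj Xs (IsSet βs θs)) * XtilS Xs βs θs) *ᵥ b)) := by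
  rw [projYpool, Ypool, Xpool, fromRows_mulVec, ← inv_sqrt_mul_self nt, ← inv_sqrt_mul_self ns]
  simp only [dotProduct, Fintype.sum_sum_type, Pi.sub_apply, Sum.elim_inl, Sum.elim_inr,
    smul_mulVec, Pi.smul_apply, smul_eq_mul, Finset.mul_sum]
  congr 1 <;> exact Finset.sum_congr rfl fun _ _ => by ring

/-- On feasible points the objective is a constant plus three quadratic forms, in the
transferable component and in the two domain-specific components. -/
theorem feas.obj_eq {βs : Fin dt → ℝ} {θs : Fin ds → ℝ} (hAtc : ∃ j, βs j = 0)
    (hIt : IsUnit ((colsub Xt (ItSet βs θs))ᵀ * colsub Xt (ItSet βs θs)).det)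
    (hIs : IsUnit ((colsub Xs (IsSet βs θs))ᵀ * colsub Xs (IsSet βs θs)).det)
    (hXp : IsUnit ((Xpool Xt Xs βs θs)ᵀ * Xpool Xt Xs βs θs).det)
    {p : (Fin dt → ℝ) × (Fin ds → ℝ)} (hp : feas βs θs p)
    {b : {r // r ∈ TtilSet βs θs} → ℝ} (hb : (fun r => p.1 r.1) = b)
    {a : {j // j ∈ ItSet βs θs} → ℝ} (ha : (fun j => p.1 j.1) = a)
    {c : {l // l ∈ IsSet βs θs} → ℝ} (hc : (fun l => p.2 l.1) = c) :
    obj Xt Yt Xs Ys p =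
      (projYpool Xt Yt Xs Ys βs θs - Xpool Xt Xs βs θs *ᵥ betaHatTtil Xt Yt Xs Ys βs θs) ⬝ᵥ
          (projYpool Xt Yt Xs Ys βs θs - Xpool Xt Xs βs θs *ᵥ betaHatTtil Xt Yt Xs Ys βs θs) +
        (Xpool Xt Xs βs θs *ᵥ (b - betaHatTtil Xt Yt Xs Ys βs θs)) ⬝ᵥ
          (Xpool Xt Xs βs θs *ᵥ (b - betaHatTtil Xt Yt Xs Ys βs θs)) +
        (nt : ℝ)⁻¹ *
          ((colsub Xt (ItSet βs θs) *ᵥ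
              (a - lsCoef (colsub Xt (ItSet βs θs)) (Yt - XtilT Xt βs θs *ᵥ b))) ⬝ᵥ
            (colsub Xt (ItSet βs θs) *ᵥ
              (a - lsCoef (colsub Xt (ItSet βs θs)) (Yt - XtilT Xt βs θs *ᵥ b)))) +
        (ns : ℝ)⁻¹ *
          ((colsub Xs (IsSet βs θs) *ᵥ
              (c - lsCoef (colsub Xs (IsSet βs θs)) (Ys - XtilS Xs βs θs *ᵥ b))) ⬝ᵥ
            (colsub Xs (IsSet βs θs) *ᵥ
              (c - lsCoef (colsub Xs (IsSet βs θs)) (Ys - XtilS Xs βs θs *ᵥ b)))) := by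
  have hobj : obj Xt Yt Xs Ys p =
      (nt : ℝ)⁻¹ * ((Yt - Xt *ᵥ p.1) ⬝ᵥ (Yt - Xt *ᵥ p.1)) +
        (ns : ℝ)⁻¹ * ((Ys - Xs *ᵥ p.2) ⬝ᵥ (Ys - Xs *ᵥ p.2)) := by
    simp only [obj, dotProduct, Pi.sub_apply, sq]
  rw [hobj, hp.mulVec_fst, hp.mulVec_snd hAtc, hb, ha, hc, profile_residual _ _ hIt,
    profile_residual _ _ hIs, ← lsCoef_projYpool Xt Yt Xs Ys βs θs hIt hIs,
    ← residual_pythagoras _ hXp, pooled_residual]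
  ring

end Pooled

theorem oracle_unique_and_closed_form {nt ns dt ds : ℕ} (hnt : 0 < nt) (hns : 0 < ns)
    (Xt : Matrix (Fin nt) (Fin dt) ℝ) (Yt : Fin nt → ℝ)
    (Xs : Matrix (Fin ns) (Fin ds) ℝ) (Ys : Fin ns → ℝ)
    (βs : Fin dt → ℝ) (θs : Fin ds → ℝ)
    -- `A_t^c ≠ ∅`
    (hAtc : ∃ j, βs j = 0)
    -- `X^(t)_{I_t}` and `X^(s)_{I_s}` have full column rank
    (hIt : IsUnit ((colsub Xt (ItSet βs θs))ᵀ * colsub Xt (ItSet βs θs)).det)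
    (hIs : IsUnit ((colsub Xs (IsSet βs θs))ᵀ * colsub Xs (IsSet βs θs)).det)
    -- the pooled projected design `X̃_{T̃_t}` has full column rank
    (hXp : IsUnit ((Xpool Xt Xs βs θs)ᵀ * Xpool Xt Xs βs θs).det) :
    (∃! p : (Fin dt → ℝ) × (Fin ds → ℝ), isOracleMin Xt Yt Xs Ys βs θs p) ∧
    ∀ p : (Fin dt → ℝ) × (Fin ds → ℝ), isOracleMin Xt Yt Xs Ys βs θs p →
      ∀ r : {r // r ∈ TtilSet βs θs}, p.1 r.1 = betaHatTtil Xt Yt Xs Ys βs θs r := by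
  set b₀ := betaHatTtil Xt Yt Xs Ys βs θs with hb₀
  set a₀ := lsCoef (colsub Xt (ItSet βs θs)) (Yt - XtilT Xt βs θs *ᵥ b₀) with ha₀
  set c₀ := lsCoef (colsub Xs (IsSet βs θs)) (Ys - XtilS Xs βs θs *ᵥ b₀) with hc₀
  have hfeas := feas_assemble βs θs b₀ a₀ c₀
  have hobj₀ := hfeas.obj_eq Xt Yt Xs Ys hAtc hIt hIs hXp
    (assemble_fst_representative βs θs b₀ a₀ c₀) (assemble_fst_specific βs θs b₀ a₀ c₀)
    (assemble_snd_specific βs θs b₀ a₀ c₀)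
  simp only [← hb₀, ← ha₀, ← hc₀, sub_self, mulVec_zero, dotProduct_zero, mul_zero,
    add_zero] at hobj₀
  have hnt' : (0 : ℝ) < (nt : ℝ)⁻¹ := inv_pos.mpr (Nat.cast_pos.mpr hnt)
  have hns' : (0 : ℝ) < (ns : ℝ)⁻¹ := inv_pos.mpr (Nat.cast_pos.mpr hns)
  have hmin : isOracleMin Xt Yt Xs Ys βs θs (assemble βs θs b₀ a₀ c₀) := by
    refine ⟨hfeas, fun q hq => ?_⟩
    rw [hobj₀, hq.obj_eq Xt Yt Xs Ys hAtc hIt hIs hXp rfl rfl rfl, add_assoc, add_assoc]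
    refine le_add_of_nonneg_right (add_nonneg (mulVec_dotProduct_self_nonneg _ _)
      (add_nonneg ?_ ?_))
    · exact mul_nonneg hnt'.le (mulVec_dotProduct_self_nonneg _ _)
    · exact mul_nonneg hns'.le (mulVec_dotProduct_self_nonneg _ _)
  have huniq : ∀ p, isOracleMin Xt Yt Xs Ys βs θs p → p = assemble βs θs b₀ a₀ c₀ := by
    intro p hp
    have hle := hp.2 _ hfeas
    obtain ⟨b, hb⟩ : ∃ b : {r // r ∈ TtilSet βs θs} → ℝ, (fun r => p.1 r.1) = b := ⟨_, rfl⟩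
    obtain ⟨a, ha⟩ : ∃ a : {j // j ∈ ItSet βs θs} → ℝ, (fun j => p.1 j.1) = a := ⟨_, rfl⟩
    obtain ⟨c, hc⟩ : ∃ c : {l // l ∈ IsSet βs θs} → ℝ, (fun l => p.2 l.1) = c := ⟨_, rfl⟩
    rw [hobj₀, hp.1.obj_eq Xt Yt Xs Ys hAtc hIt hIs hXp hb ha hc, ← hb₀] at hle
    have h1 := mulVec_dotProduct_self_nonneg (Xpool Xt Xs βs θs) (b - b₀)
    have h2 := mul_nonneg hnt'.le (mulVec_dotProduct_self_nonneg (colsub Xt (ItSet βs θs))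
      (a - lsCoef (colsub Xt (ItSet βs θs)) (Yt - XtilT Xt βs θs *ᵥ b)))
    have h3 := mul_nonneg hns'.le (mulVec_dotProduct_self_nonneg (colsub Xs (IsSet βs θs))
      (c - lsCoef (colsub Xs (IsSet βs θs)) (Ys - XtilS Xs βs θs *ᵥ b)))
    have hbb : b = b₀ := sub_eq_zero.mp <|
      eq_zero_of_mulVec_dotProduct_self_eq_zero _ hXp (by linarith)
    have haa := eq_zero_of_mulVec_dotProduct_self_eq_zero _ hIt
      ((mul_eq_zero.mp (le_antisymm (by linarith) h2)).resolve_left hnt'.ne')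
    have hcc := eq_zero_of_mulVec_dotProduct_self_eq_zero _ hIs
      ((mul_eq_zero.mp (le_antisymm (by linarith) h3)).resolve_left hns'.ne')
    rw [hbb, sub_eq_zero] at haa hcc
    rw [hp.1.eq_assemble hAtc, hb, ha, hc, hbb, haa, hcc]
  refine ⟨⟨_, hmin, huniq⟩, fun p hp r => ?_⟩
  rw [huniq p hp]
  exact congrFun (assemble_fst_representative βs θs b₀ a₀ c₀) r

end CSTL2
end
end

section
/- In the same constrained least-squares (oracle) problem, under the same assumptions (A_t^c ≠ ∅; X^(t)_{I_t} and X^(s)_{I_s} of full column rank; the pooled projected design X̃_{T̃_t} of full column rank), the unique minimizer (β̂_ora, θ̂_ora) satisfies β̂_{ora, I_t} = [(X^(t)_{I_t})ᵀ X^(t)_{I_t}]⁻¹ (X^(t)_{I_t})ᵀ (Y^(t) − X̃^(t)_{T̃_t} β̂_{ora, T̃_t}) and β̂_{ora, A_t^c} = 0; that is, the target-specific coefficients are obtained by regressing the target residuals, after subtracting the fitted transferable part, on the target-specific covariates. -/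
/-! Statement 3: the target-specific component of the unique oracle minimizer. -/
open Matrix
open scoped Classical

noncomputable section

namespace CSTL3

variable {nt ns dt ds : ℕ}

/-- Target transferable set `T_t`. -/
def TtSet (βs : Fin dt → ℝ) (θs : Fin ds → ℝ) : Set (Fin dt) :=
  {j | βs j ≠ 0 ∧ ∃ l, θs l ≠ 0 ∧ βs j = θs l}

/-- Source transferable set `T_s`. -/
def TsSet (βs : Fin dt → ℝ) (θs : Fin ds → ℝ) : Set (Fin ds) :=
  {l | θs l ≠ 0 ∧ ∃ j, βs j ≠ 0 ∧ θs l = βs j}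

/-- Canonical representative set `T̃_t`. -/
def TtilSet (βs : Fin dt → ℝ) (θs : Fin ds → ℝ) : Set (Fin dt) :=
  {j | j ∈ TtSet βs θs ∧ ∀ j' ∈ TtSet βs θs, βs j' = βs j → j ≤ j'}

/-- Target-specific set `I_t = A_t \ T_t`. -/
def ItSet (βs : Fin dt → ℝ) (θs : Fin ds → ℝ) : Set (Fin dt) :=
  {j | βs j ≠ 0} \ TtSet βs θs

/-- Source-specific set `I_s = A_s \ T_s`. -/
def IsSet (βs : Fin dt → ℝ) (θs : Fin ds → ℝ) : Set (Fin ds) :=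
  {l | θs l ≠ 0} \ TsSet βs θs

/-- Target matching matrix `M^(t)`. -/
def Mmt (βs : Fin dt → ℝ) (θs : Fin ds → ℝ) :
    Matrix {j // j ∈ TtSet βs θs} {r // r ∈ TtilSet βs θs} ℝ :=
  Matrix.of fun j r => if βs j.1 = βs r.1 then 1 else 0

/-- Source matching matrix `M^(s)`. -/
def Mms (βs : Fin dt → ℝ) (θs : Fin ds → ℝ) :
    Matrix {l // l ∈ TsSet βs θs} {r // r ∈ TtilSet βs θs} ℝ :=
  Matrix.of fun l r => if θs l.1 = βs r.1 then 1 else 0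

/-- Column submatrix `X_S`. -/
def colsub {n d : ℕ} (X : Matrix (Fin n) (Fin d) ℝ) (S : Set (Fin d)) :
    Matrix (Fin n) {j // j ∈ S} ℝ :=
  X.submatrix id Subtype.val

/-- Projection matrix `P_S = X_S [(X_S)ᵀ X_S]⁻¹ (X_S)ᵀ`. -/
def proj {n d : ℕ} (X : Matrix (Fin n) (Fin d) ℝ) (S : Set (Fin d)) :
    Matrix (Fin n) (Fin n) ℝ :=
  colsub X S * ((colsub X S)ᵀ * colsub X S)⁻¹ * (colsub X S)ᵀ

/-- Merged transferable target design `X̃^(t)_{T̃_t} = X^(t)_{T_t} M^(t)`. -/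
def XtilT (Xt : Matrix (Fin nt) (Fin dt) ℝ) (βs : Fin dt → ℝ) (θs : Fin ds → ℝ) :
    Matrix (Fin nt) {r // r ∈ TtilSet βs θs} ℝ :=
  colsub Xt (TtSet βs θs) * Mmt βs θs

/-- Merged transferable source design `X̃^(s)_{T̃_t} = X^(s)_{T_s} M^(s)`. -/
def XtilS (Xs : Matrix (Fin ns) (Fin ds) ℝ) (βs : Fin dt → ℝ) (θs : Fin ds → ℝ) :
    Matrix (Fin ns) {r // r ∈ TtilSet βs θs} ℝ :=
  colsub Xs (TsSet βs θs) * Mms βs θs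

/-- Pooled projected design `X̃_{T̃_t}`. -/
def Xpool (Xt : Matrix (Fin nt) (Fin dt) ℝ) (Xs : Matrix (Fin ns) (Fin ds) ℝ)
    (βs : Fin dt → ℝ) (θs : Fin ds → ℝ) :
    Matrix (Fin nt ⊕ Fin ns) {r // r ∈ TtilSet βs θs} ℝ :=
  Matrix.fromRows
    ((Real.sqrt nt)⁻¹ • ((1 - proj Xt (ItSet βs θs)) * XtilT Xt βs θs))
    ((Real.sqrt ns)⁻¹ • ((1 - proj Xs (IsSet βs θs)) * XtilS Xs βs θs))

/-- Pooled response `Y`. -/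
def Ypool (Yt : Fin nt → ℝ) (Ys : Fin ns → ℝ) : (Fin nt ⊕ Fin ns) → ℝ :=
  Sum.elim ((Real.sqrt nt)⁻¹ • Yt) ((Real.sqrt ns)⁻¹ • Ys)

/-- Feasibility for the oracle problem: `β_{A_t^c} = 0` and `β_j = θ_l`
for all `(j,l) ∈ B = {(j,l) : β*_j = θ*_l}`. -/
def feas (βs : Fin dt → ℝ) (θs : Fin ds → ℝ)
    (p : (Fin dt → ℝ) × (Fin ds → ℝ)) : Prop :=
  (∀ j, βs j = 0 → p.1 j = 0) ∧ ∀ j l, βs j = θs l → p.1 j = p.2 l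

/-- The two-domain least-squares objective. -/
def obj (Xt : Matrix (Fin nt) (Fin dt) ℝ) (Yt : Fin nt → ℝ)
    (Xs : Matrix (Fin ns) (Fin ds) ℝ) (Ys : Fin ns → ℝ)
    (p : (Fin dt → ℝ) × (Fin ds → ℝ)) : ℝ :=
  (nt : ℝ)⁻¹ * ∑ i, (Yt i - (Xt *ᵥ p.1) i) ^ 2 +
    (ns : ℝ)⁻¹ * ∑ i, (Ys i - (Xs *ᵥ p.2) i) ^ 2

/-- A minimizer of the constrained (oracle) least-squares problem. -/
def isOracleMin (Xt : Matrix (Fin nt) (Fin dt) ℝ) (Yt : Fin nt → ℝ)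
    (Xs : Matrix (Fin ns) (Fin ds) ℝ) (Ys : Fin ns → ℝ)
    (βs : Fin dt → ℝ) (θs : Fin ds → ℝ)
    (p : (Fin dt → ℝ) × (Fin ds → ℝ)) : Prop :=
  feas βs θs p ∧ ∀ q, feas βs θs q → obj Xt Yt Xs Ys p ≤ obj Xt Yt Xs Ys q

/-- Closed-form expression `[(X̃_{T̃_t})ᵀ X̃_{T̃_t}]⁻¹ (X̃_{T̃_t})ᵀ Y`. -/
def betaHatTtil (Xt : Matrix (Fin nt) (Fin dt) ℝ) (Yt : Fin nt → ℝ)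
    (Xs : Matrix (Fin ns) (Fin ds) ℝ) (Ys : Fin ns → ℝ)
    (βs : Fin dt → ℝ) (θs : Fin ds → ℝ) : {r // r ∈ TtilSet βs θs} → ℝ :=
  ((Xpool Xt Xs βs θs)ᵀ * Xpool Xt Xs βs θs)⁻¹ *ᵥ
    ((Xpool Xt Xs βs θs)ᵀ *ᵥ Ypool Yt Ys)

section LeastSquares

variable {m m₁ m₂ k k₁ k₂ r : Type*} [Fintype m] [Fintype m₁] [Fintype m₂] [Fintype k]
  [Fintype k₁] [Fintype k₂] [Fintype r] [DecidableEq m] [DecidableEq m₁] [DecidableEq m₂]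
  [DecidableEq k] [DecidableEq k₁] [DecidableEq k₂] [DecidableEq r]

/-- The residual maker `I - A (Aᵀ A)⁻¹ Aᵀ` of a design matrix `A`. -/
def residualMaker (A : Matrix m k ℝ) : Matrix m m ℝ := 1 - A * (Aᵀ * A)⁻¹ * Aᵀ

/-- The least-squares coefficients `(Aᵀ A)⁻¹ Aᵀ y`. -/
def lsCoef (A : Matrix m k ℝ) (y : m → ℝ) : k → ℝ := (Aᵀ * A)⁻¹ *ᵥ (Aᵀ *ᵥ y)

lemma residualMaker_transpose (A : Matrix m k ℝ) : (residualMaker A)ᵀ = residualMaker A := by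
  simp [residualMaker, Matrix.transpose_mul, Matrix.transpose_nonsing_inv, Matrix.mul_assoc]

lemma residualMaker_mul_self (A : Matrix m k ℝ) (hA : IsUnit (Aᵀ * A).det) :
    residualMaker A * A = 0 := by
  rw [residualMaker, Matrix.sub_mul, Matrix.mul_assoc, Matrix.mul_assoc,
    Matrix.nonsing_inv_mul _ hA]
  simp

lemma transpose_mul_residualMaker (A : Matrix m k ℝ) (hA : IsUnit (Aᵀ * A).det) :
    Aᵀ * residualMaker A = 0 := by
  have h := congrArg Matrix.transpose (residualMaker_mul_self A hA)
  rwa [Matrix.transpose_mul, residualMaker_transpose, Matrix.transpose_zero] at h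

lemma residualMaker_idem (A : Matrix m k ℝ) (hA : IsUnit (Aᵀ * A).det) :
    residualMaker A * residualMaker A = residualMaker A := by
  calc residualMaker A * residualMaker A
      = (1 - A * (Aᵀ * A)⁻¹ * Aᵀ) * residualMaker A := rfl
    _ = residualMaker A := by
      rw [Matrix.sub_mul, Matrix.mul_assoc, transpose_mul_residualMaker A hA, Matrix.mul_zero,
        Matrix.one_mul, sub_zero]

lemma residualMaker_mulVec (A : Matrix m k ℝ) (y : m → ℝ) :
    residualMaker A *ᵥ y = y - A *ᵥ lsCoef A y := by
  simp [residualMaker, lsCoef, Matrix.sub_mulVec, Matrix.mulVec_mulVec, Matrix.mul_assoc]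

omit [DecidableEq m] in
lemma eq_zero_of_mulVec_eq_zero (A : Matrix m k ℝ) (hA : IsUnit (Aᵀ * A).det) (x : k → ℝ)
    (hx : A *ᵥ x = 0) : x = 0 := by
  have h : (Aᵀ * A) *ᵥ x = 0 := by rw [← Matrix.mulVec_mulVec, hx, Matrix.mulVec_zero]
  rw [← Matrix.one_mulVec x, ← Matrix.nonsing_inv_mul _ hA, ← Matrix.mulVec_mulVec, h,
    Matrix.mulVec_zero]

lemma transpose_mulVec_residual (A : Matrix m k ℝ) (hA : IsUnit (Aᵀ * A).det) (y : m → ℝ) :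
    Aᵀ *ᵥ (y - A *ᵥ lsCoef A y) = 0 := by
  rw [← residualMaker_mulVec, Matrix.mulVec_mulVec, transpose_mul_residualMaker A hA,
    Matrix.zero_mulVec]

/-- The stacked, weighted, projected design. -/
def pooledDesign (s₁ s₂ : ℝ) (A₁ : Matrix m₁ k₁ ℝ) (A₂ : Matrix m₂ k₂ ℝ)
    (C₁ : Matrix m₁ r ℝ) (C₂ : Matrix m₂ r ℝ) : Matrix (m₁ ⊕ m₂) r ℝ :=
  Matrix.fromRows (s₁ • (residualMaker A₁ * C₁)) (s₂ • (residualMaker A₂ * C₂))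

omit [DecidableEq r] in
lemma transpose_smul_residualMaker_mul_mulVec (s : ℝ) (A : Matrix m k ℝ) (C : Matrix m r ℝ)
    (y : m → ℝ) (b : r → ℝ) (hA : IsUnit (Aᵀ * A).det) :
    (s • (residualMaker A * C))ᵀ *ᵥ (s • (y - residualMaker A *ᵥ (C *ᵥ b))) =
      s ^ 2 • (Cᵀ *ᵥ (residualMaker A *ᵥ (y - C *ᵥ b))) := by
  rw [Matrix.transpose_smul, Matrix.transpose_mul, residualMaker_transpose, Matrix.smul_mulVec,
    Matrix.mulVec_smul, smul_smul, ← sq, ← Matrix.mulVec_mulVec, Matrix.mulVec_sub (residualMaker A),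
    Matrix.mulVec_mulVec (C *ᵥ b), residualMaker_idem A hA, ← Matrix.mulVec_sub]

lemma pooledDesign_normal_equation (s₁ s₂ : ℝ) (A₁ : Matrix m₁ k₁ ℝ) (A₂ : Matrix m₂ k₂ ℝ)
    (C₁ : Matrix m₁ r ℝ) (C₂ : Matrix m₂ r ℝ) (y₁ : m₁ → ℝ) (y₂ : m₂ → ℝ)
    (hA₁ : IsUnit (A₁ᵀ * A₁).det) (hA₂ : IsUnit (A₂ᵀ * A₂).det)
    (hX : IsUnit ((pooledDesign s₁ s₂ A₁ A₂ C₁ C₂)ᵀ * pooledDesign s₁ s₂ A₁ A₂ C₁ C₂).det)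
    (b : r → ℝ)
    (hb : b = lsCoef (pooledDesign s₁ s₂ A₁ A₂ C₁ C₂) (Sum.elim (s₁ • y₁) (s₂ • y₂))) :
    s₁ ^ 2 • (C₁ᵀ *ᵥ (residualMaker A₁ *ᵥ (y₁ - C₁ *ᵥ b))) +
      s₂ ^ 2 • (C₂ᵀ *ᵥ (residualMaker A₂ *ᵥ (y₂ - C₂ *ᵥ b))) = 0 := by
  have h := transpose_mulVec_residual _ hX (Sum.elim (s₁ • y₁) (s₂ • y₂))
  rw [← hb] at h
  have hs : Sum.elim (s₁ • y₁) (s₂ • y₂) - pooledDesign s₁ s₂ A₁ A₂ C₁ C₂ *ᵥ b =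
      Sum.elim (s₁ • (y₁ - residualMaker A₁ *ᵥ (C₁ *ᵥ b)))
        (s₂ • (y₂ - residualMaker A₂ *ᵥ (C₂ *ᵥ b))) := by
    ext (i | i) <;>
      simp [pooledDesign, Matrix.fromRows_mulVec, Matrix.smul_mulVec, Matrix.mulVec_mulVec, mul_sub]
  rw [hs, pooledDesign, Matrix.transpose_fromRows, Matrix.fromCols_mulVec] at h
  simp only [Sum.elim_comp_inl, Sum.elim_comp_inr] at h
  rwa [transpose_smul_residualMaker_mul_mulVec s₁ A₁ C₁ y₁ b hA₁,
    transpose_smul_residualMaker_mul_mulVec s₂ A₂ C₂ y₂ b hA₂] at h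

omit [DecidableEq r] in
lemma sum_sq_residual_expand (A : Matrix m k ℝ) (C : Matrix m r ℝ) (y : m → ℝ)
    (hA : IsUnit (Aᵀ * A).det) (b b' : r → ℝ) (u' : k → ℝ) :
    ∑ i, (y i - (A *ᵥ u' + C *ᵥ b') i) ^ 2 =
      ∑ i, (y i - (A *ᵥ lsCoef A (y - C *ᵥ b) + C *ᵥ b) i) ^ 2
      - 2 * (Cᵀ *ᵥ (residualMaker A *ᵥ (y - C *ᵥ b)) ⬝ᵥ (b' - b))
      + ∑ i, ((A *ᵥ (u' - lsCoef A (y - C *ᵥ b)) + C *ᵥ (b' - b)) i) ^ 2 := by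
  set u := lsCoef A (y - C *ᵥ b) with hu
  set ρ := residualMaker A *ᵥ (y - C *ᵥ b) with hρ
  have hρ' : ρ = y - C *ᵥ b - A *ᵥ u := residualMaker_mulVec _ _
  have h0 : ρ ⬝ᵥ (A *ᵥ (u' - u) + C *ᵥ (b' - b)) = Cᵀ *ᵥ ρ ⬝ᵥ (b' - b) := by
    have h1 : Aᵀ *ᵥ ρ = 0 := by
      rw [hρ, Matrix.mulVec_mulVec, transpose_mul_residualMaker A hA, Matrix.zero_mulVec]
    rw [dotProduct_add, Matrix.dotProduct_mulVec, Matrix.dotProduct_mulVec,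
      ← Matrix.mulVec_transpose, ← Matrix.mulVec_transpose, h1, zero_dotProduct, zero_add]
  rw [← h0, dotProduct, Finset.mul_sum, ← Finset.sum_sub_distrib, ← Finset.sum_add_distrib]
  refine Finset.sum_congr rfl fun i _ => ?_
  rw [hρ', Matrix.mulVec_sub, Matrix.mulVec_sub]
  simp only [Pi.add_apply, Pi.sub_apply]
  ring

/-- The weighted two-sample sum of squared residuals with a shared coefficient vector `b`. -/
def pooledLoss (s₁ s₂ : ℝ) (A₁ : Matrix m₁ k₁ ℝ) (A₂ : Matrix m₂ k₂ ℝ)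
    (C₁ : Matrix m₁ r ℝ) (C₂ : Matrix m₂ r ℝ) (y₁ : m₁ → ℝ) (y₂ : m₂ → ℝ)
    (b : r → ℝ) (u : k₁ → ℝ) (v : k₂ → ℝ) : ℝ :=
  s₁ ^ 2 * ∑ i, (y₁ i - (A₁ *ᵥ u + C₁ *ᵥ b) i) ^ 2 +
    s₂ ^ 2 * ∑ i, (y₂ i - (A₂ *ᵥ v + C₂ *ᵥ b) i) ^ 2

section

variable (s₁ s₂ : ℝ) (A₁ : Matrix m₁ k₁ ℝ) (A₂ : Matrix m₂ k₂ ℝ)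
    (C₁ : Matrix m₁ r ℝ) (C₂ : Matrix m₂ r ℝ) (y₁ : m₁ → ℝ) (y₂ : m₂ → ℝ)
    (hA₁ : IsUnit (A₁ᵀ * A₁).det) (hA₂ : IsUnit (A₂ᵀ * A₂).det)
    (hX : IsUnit ((pooledDesign s₁ s₂ A₁ A₂ C₁ C₂)ᵀ * pooledDesign s₁ s₂ A₁ A₂ C₁ C₂).det)
    (b : r → ℝ)
    (hb : b = lsCoef (pooledDesign s₁ s₂ A₁ A₂ C₁ C₂) (Sum.elim (s₁ • y₁) (s₂ • y₂)))

include hA₁ hA₂ hX hb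

lemma pooledLoss_eq_add (b' : r → ℝ) (u' : k₁ → ℝ) (v' : k₂ → ℝ) :
    pooledLoss s₁ s₂ A₁ A₂ C₁ C₂ y₁ y₂ b' u' v' =
      pooledLoss s₁ s₂ A₁ A₂ C₁ C₂ y₁ y₂ b
        (lsCoef A₁ (y₁ - C₁ *ᵥ b)) (lsCoef A₂ (y₂ - C₂ *ᵥ b)) +
      (s₁ ^ 2 * ∑ i, ((A₁ *ᵥ (u' - lsCoef A₁ (y₁ - C₁ *ᵥ b)) + C₁ *ᵥ (b' - b)) i) ^ 2 +
       s₂ ^ 2 * ∑ i, ((A₂ *ᵥ (v' - lsCoef A₂ (y₂ - C₂ *ᵥ b)) + C₂ *ᵥ (b' - b)) i) ^ 2) := by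
  have h := congrArg (· ⬝ᵥ (b' - b))
    (pooledDesign_normal_equation s₁ s₂ A₁ A₂ C₁ C₂ y₁ y₂ hA₁ hA₂ hX b hb)
  simp only [add_dotProduct, smul_dotProduct, zero_dotProduct, smul_eq_mul] at h
  rw [pooledLoss, pooledLoss, sum_sq_residual_expand A₁ C₁ y₁ hA₁ b b' u',
    sum_sq_residual_expand A₂ C₂ y₂ hA₂ b b' v']
  linear_combination (-2) * h

lemma pooledLoss_min_le (b' : r → ℝ) (u' : k₁ → ℝ) (v' : k₂ → ℝ) :
    pooledLoss s₁ s₂ A₁ A₂ C₁ C₂ y₁ y₂ b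
        (lsCoef A₁ (y₁ - C₁ *ᵥ b)) (lsCoef A₂ (y₂ - C₂ *ᵥ b)) ≤
      pooledLoss s₁ s₂ A₁ A₂ C₁ C₂ y₁ y₂ b' u' v' := by
  rw [pooledLoss_eq_add s₁ s₂ A₁ A₂ C₁ C₂ y₁ y₂ hA₁ hA₂ hX b hb b' u' v']
  exact le_add_of_nonneg_right (by positivity)

lemma eq_of_pooledLoss_le (hs₁ : s₁ ≠ 0) (hs₂ : s₂ ≠ 0)
    (b' : r → ℝ) (u' : k₁ → ℝ) (v' : k₂ → ℝ)
    (hle : pooledLoss s₁ s₂ A₁ A₂ C₁ C₂ y₁ y₂ b' u' v' ≤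
      pooledLoss s₁ s₂ A₁ A₂ C₁ C₂ y₁ y₂ b
        (lsCoef A₁ (y₁ - C₁ *ᵥ b)) (lsCoef A₂ (y₂ - C₂ *ᵥ b))) :
    b' = b ∧ u' = lsCoef A₁ (y₁ - C₁ *ᵥ b) ∧ v' = lsCoef A₂ (y₂ - C₂ *ᵥ b) := by
  rw [pooledLoss_eq_add s₁ s₂ A₁ A₂ C₁ C₂ y₁ y₂ hA₁ hA₂ hX b hb b' u' v'] at hle
  set u := lsCoef A₁ (y₁ - C₁ *ᵥ b)
  set v := lsCoef A₂ (y₂ - C₂ *ᵥ b)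
  have hp₁ : 0 < s₁ ^ 2 := by positivity
  have hp₂ : 0 < s₂ ^ 2 := by positivity
  have hn₁ : 0 ≤ ∑ i, ((A₁ *ᵥ (u' - u) + C₁ *ᵥ (b' - b)) i) ^ 2 := by positivity
  have hn₂ : 0 ≤ ∑ i, ((A₂ *ᵥ (v' - v) + C₂ *ᵥ (b' - b)) i) ^ 2 := by positivity
  have hz₁ : ∑ i, ((A₁ *ᵥ (u' - u) + C₁ *ᵥ (b' - b)) i) ^ 2 = 0 := by nlinarith
  have hz₂ : ∑ i, ((A₂ *ᵥ (v' - v) + C₂ *ᵥ (b' - b)) i) ^ 2 = 0 := by nlinarith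
  have e₁ : A₁ *ᵥ (u' - u) + C₁ *ᵥ (b' - b) = 0 := by
    ext i
    exact pow_eq_zero_iff two_ne_zero |>.1
      ((Finset.sum_eq_zero_iff_of_nonneg fun i _ => sq_nonneg _).1 hz₁ i (Finset.mem_univ i))
  have e₂ : A₂ *ᵥ (v' - v) + C₂ *ᵥ (b' - b) = 0 := by
    ext i
    exact pow_eq_zero_iff two_ne_zero |>.1
      ((Finset.sum_eq_zero_iff_of_nonneg fun i _ => sq_nonneg _).1 hz₂ i (Finset.mem_univ i))
  have q₁ : (residualMaker A₁ * C₁) *ᵥ (b' - b) = 0 := by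
    have := congrArg (residualMaker A₁ *ᵥ ·) e₁
    simpa [Matrix.mulVec_add, Matrix.mulVec_mulVec, residualMaker_mul_self A₁ hA₁] using this
  have q₂ : (residualMaker A₂ * C₂) *ᵥ (b' - b) = 0 := by
    have := congrArg (residualMaker A₂ *ᵥ ·) e₂
    simpa [Matrix.mulVec_add, Matrix.mulVec_mulVec, residualMaker_mul_self A₂ hA₂] using this
  have hb0 : b' - b = 0 := by
    apply eq_zero_of_mulVec_eq_zero _ hX
    rw [pooledDesign, Matrix.fromRows_mulVec, Matrix.smul_mulVec, Matrix.smul_mulVec, q₁, q₂]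
    ext (i | i) <;> simp
  rw [hb0, Matrix.mulVec_zero, add_zero] at e₁ e₂
  exact ⟨sub_eq_zero.1 hb0, sub_eq_zero.1 (eq_zero_of_mulVec_eq_zero A₁ hA₁ _ e₁),
    sub_eq_zero.1 (eq_zero_of_mulVec_eq_zero A₂ hA₂ _ e₂)⟩

end

end LeastSquares

section Assembly

variable {d : ℕ} {r : Type*} [Fintype r]

/-- The coefficient vector with entries `u` on `I` and, at every other coordinate `j`,
the shared value `b i` for the representative `i` with `g i = f j`. -/
def assemble (f : Fin d → ℝ) (g : r → ℝ) (I : Set (Fin d)) (b : r → ℝ)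
    (u : {j // j ∈ I} → ℝ) : Fin d → ℝ :=
  fun j => (if h : j ∈ I then u ⟨j, h⟩ else 0) + ∑ i, if f j = g i then b i else 0

lemma colsub_mulVec {n : ℕ} (X : Matrix (Fin n) (Fin d) ℝ) (S : Set (Fin d))
    (u : {j // j ∈ S} → ℝ) :
    colsub X S *ᵥ u = X *ᵥ fun j => if h : j ∈ S then u ⟨j, h⟩ else 0 := by
  ext i
  simp only [Matrix.mulVec, dotProduct, colsub, Matrix.submatrix_apply, id]
  rw [← Finset.sum_subset (Finset.subset_univ (Finset.univ.filter (· ∈ S))),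
    Finset.sum_subtype (p := (· ∈ S)) _ (by simp)]
  · exact Finset.sum_congr rfl fun j _ => by simp [j.2]
  · intro j _ hj
    have : j ∉ S := by simpa using hj
    simp [this]

lemma mulVec_assemble {n : ℕ} (X : Matrix (Fin n) (Fin d) ℝ) (f : Fin d → ℝ) (g : r → ℝ)
    (I T : Set (Fin d)) (hT : ∀ j i, f j = g i → j ∈ T) (b : r → ℝ) (u : {j // j ∈ I} → ℝ) :
    X *ᵥ assemble f g I b u = colsub X I *ᵥ u +
      (colsub X T * Matrix.of fun (j : {j // j ∈ T}) i => if f j.1 = g i then (1 : ℝ) else 0) *ᵥ b := by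
  rw [← Matrix.mulVec_mulVec, colsub_mulVec, colsub_mulVec, ← Matrix.mulVec_add]
  congr 1
  ext j
  simp only [assemble, Pi.add_apply, Matrix.mulVec, dotProduct, Matrix.of_apply, ite_mul, one_mul,
    zero_mul]
  congr 1
  split_ifs with h
  · rfl
  · exact Finset.sum_eq_zero fun i _ => if_neg fun e => h (hT j i e)

lemma assemble_apply_of_mem (f : Fin d → ℝ) (g : r → ℝ) (I : Set (Fin d)) (b : r → ℝ)
    (u : {j // j ∈ I} → ℝ) (j : Fin d) (hj : j ∈ I) (hne : ∀ i, f j ≠ g i) :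
    assemble f g I b u j = u ⟨j, hj⟩ := by
  simp [assemble, hj, hne]

lemma assemble_apply_of_eq (f : Fin d → ℝ) (g : r → ℝ) (hg : Function.Injective g)
    (I : Set (Fin d)) (b : r → ℝ)
    (u : {j // j ∈ I} → ℝ) (j : Fin d) (hj : j ∉ I) (i : r) (h : f j = g i) :
    assemble f g I b u j = b i := by
  simp [assemble, hj, h, hg.eq_iff]

lemma assemble_apply_of_notMem (f : Fin d → ℝ) (g : r → ℝ) (I : Set (Fin d)) (b : r → ℝ)
    (u : {j // j ∈ I} → ℝ) (j : Fin d) (hj : j ∉ I) (hne : ∀ i, f j ≠ g i) :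
    assemble f g I b u j = 0 := by
  simp [assemble, hj, hne]

end Assembly

section Oracle

variable {dt ds : ℕ} (βs : Fin dt → ℝ) (θs : Fin ds → ℝ)

lemma injective_TtilSet : Function.Injective fun i : {i // i ∈ TtilSet βs θs} => βs i.1 := by
  intro i i' h
  exact Subtype.ext (le_antisymm (i.2.2 _ i'.2.1 h.symm) (i'.2.2 _ i.2.1 h))

lemma exists_mem_TtilSet {j : Fin dt} (hj : j ∈ TtSet βs θs) :
    ∃ i : {i // i ∈ TtilSet βs θs}, βs j = βs i.1 := by
  obtain ⟨i, hi, hmin⟩ := Finset.exists_min_image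
    (Finset.univ.filter fun i => i ∈ TtSet βs θs ∧ βs i = βs j) id ⟨j, by simp [hj]⟩
  simp only [Finset.mem_filter, Finset.mem_univ, true_and, id] at hi hmin
  exact ⟨⟨i, hi.1, fun j' h h' => hmin j' ⟨h, h'.trans hi.2⟩⟩, hi.2.symm⟩

lemma mem_TtSet_of_eq {j : Fin dt} (i : {i // i ∈ TtilSet βs θs}) (h : βs j = βs i.1) :
    j ∈ TtSet βs θs := by
  obtain ⟨h0, hl⟩ := i.2.1
  exact ⟨h ▸ h0, h ▸ hl⟩

lemma mem_TsSet_of_eq {l : Fin ds} (i : {i // i ∈ TtilSet βs θs}) (h : θs l = βs i.1) :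
    l ∈ TsSet βs θs :=
  ⟨h ▸ i.2.1.1, i.1, i.2.1.1, h⟩

lemma exists_mem_TtilSet_of_mem_TsSet {l : Fin ds} (hl : l ∈ TsSet βs θs) :
    ∃ i : {i // i ∈ TtilSet βs θs}, θs l = βs i.1 := by
  obtain ⟨h0, j, hj, e⟩ := hl
  obtain ⟨i, hi⟩ := exists_mem_TtilSet βs θs (j := j) ⟨hj, l, h0, e.symm⟩
  exact ⟨i, e.trans hi⟩

/-- The pair of coefficient vectors with shared part `b` and specific parts `u`, `v`. -/
def oraclePair (b : {i // i ∈ TtilSet βs θs} → ℝ) (u : {j // j ∈ ItSet βs θs} → ℝ)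
    (v : {l // l ∈ IsSet βs θs} → ℝ) : (Fin dt → ℝ) × (Fin ds → ℝ) :=
  (assemble βs (fun i : {i // i ∈ TtilSet βs θs} => βs i.1) (ItSet βs θs) b u,
    assemble θs (fun i : {i // i ∈ TtilSet βs θs} => βs i.1) (IsSet βs θs) b v)

lemma feas_oraclePair (b : {i // i ∈ TtilSet βs θs} → ℝ) (u : {j // j ∈ ItSet βs θs} → ℝ)
    (v : {l // l ∈ IsSet βs θs} → ℝ) : feas βs θs (oraclePair βs θs b u v) := by
  have ht : ∀ j, βs j = 0 → (oraclePair βs θs b u v).1 j = 0 := fun j hj =>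
    assemble_apply_of_notMem _ _ _ _ _ _ (fun h => h.1 hj)
      fun i e => i.2.1.1 (e.symm.trans hj)
  refine ⟨ht, fun j l h => ?_⟩
  by_cases hj : βs j = 0
  · rw [ht j hj]
    exact (assemble_apply_of_notMem _ _ _ _ _ _ (fun hm => hm.1 (h.symm.trans hj))
      fun i e => i.2.1.1 (e.symm.trans (h.symm.trans hj))).symm
  · have hjT : j ∈ TtSet βs θs := ⟨hj, l, h ▸ hj, h⟩
    have hlT : l ∈ TsSet βs θs := ⟨h ▸ hj, j, hj, h.symm⟩
    obtain ⟨i, hi⟩ := exists_mem_TtilSet βs θs hjT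
    have hg := injective_TtilSet βs θs
    exact (assemble_apply_of_eq _ _ hg _ _ _ _ (fun hm => hm.2 hjT) i hi).trans
      (assemble_apply_of_eq _ _ hg _ _ _ _ (fun hm => hm.2 hlT) i (h.symm.trans hi)).symm

lemma oraclePair_fst_apply (b : {i // i ∈ TtilSet βs θs} → ℝ) (u : {j // j ∈ ItSet βs θs} → ℝ)
    (v : {l // l ∈ IsSet βs θs} → ℝ) (j : {j // j ∈ ItSet βs θs}) :
    (oraclePair βs θs b u v).1 j.1 = u j :=
  assemble_apply_of_mem _ _ _ _ _ _ j.2 fun i e => j.2.2 (mem_TtSet_of_eq βs θs i e)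

lemma exists_eq_oraclePair (h0 : ∃ j, βs j = 0) {p : (Fin dt → ℝ) × (Fin ds → ℝ)}
    (hp : feas βs θs p) : ∃ b u v, p = oraclePair βs θs b u v := by
  have hg := injective_TtilSet βs θs
  let b : {i // i ∈ TtilSet βs θs} → ℝ := fun i => p.1 i.1
  let u : {j // j ∈ ItSet βs θs} → ℝ := fun j => p.1 j.1
  let v : {l // l ∈ IsSet βs θs} → ℝ := fun l => p.2 l.1
  have hq := feas_oraclePair βs θs b u v
  refine ⟨b, u, v, Prod.ext (funext fun j => ?_) (funext fun l => ?_)⟩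
  · by_cases hj : βs j = 0
    · rw [hp.1 j hj, hq.1 j hj]
    by_cases hT : j ∈ TtSet βs θs
    · obtain ⟨i, hi⟩ := exists_mem_TtilSet βs θs hT
      have hjI : j ∉ ItSet βs θs := fun hm => hm.2 hT
      obtain ⟨-, l, -, hl⟩ := hT
      have e : (oraclePair βs θs b u v).1 j = p.1 i.1 :=
        assemble_apply_of_eq _ _ hg _ b u j hjI i hi
      rw [e, hp.2 j l hl, hp.2 i.1 l (hi.symm.trans hl)]
    · exact (oraclePair_fst_apply βs θs b u v ⟨j, hj, hT⟩).symm
  · by_cases hl : θs l = 0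
    · obtain ⟨j, hj⟩ := h0
      have e : βs j = θs l := hj.trans hl.symm
      rw [← hp.2 j l e, hp.1 j hj, ← hq.2 j l e, hq.1 j hj]
    by_cases hT : l ∈ TsSet βs θs
    · obtain ⟨i, hi⟩ := exists_mem_TtilSet_of_mem_TsSet βs θs hT
      have hlI : l ∉ IsSet βs θs := fun hm => hm.2 hT
      have e : (oraclePair βs θs b u v).2 l = p.1 i.1 :=
        assemble_apply_of_eq _ _ hg _ b v l hlI i hi
      rw [e, hp.2 i.1 l hi.symm]
    · exact (assemble_apply_of_mem θs _ _ b v l ⟨hl, hT⟩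
        fun i e => hT (mem_TsSet_of_eq βs θs i e)).symm

lemma obj_oraclePair {nt ns : ℕ} (Xt : Matrix (Fin nt) (Fin dt) ℝ) (Yt : Fin nt → ℝ)
    (Xs : Matrix (Fin ns) (Fin ds) ℝ) (Ys : Fin ns → ℝ)
    (b : {i // i ∈ TtilSet βs θs} → ℝ) (u : {j // j ∈ ItSet βs θs} → ℝ)
    (v : {l // l ∈ IsSet βs θs} → ℝ) :
    obj Xt Yt Xs Ys (oraclePair βs θs b u v) =
      pooledLoss (Real.sqrt nt)⁻¹ (Real.sqrt ns)⁻¹ (colsub Xt (ItSet βs θs))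
        (colsub Xs (IsSet βs θs)) (XtilT Xt βs θs) (XtilS Xs βs θs) Yt Ys b u v := by
  have e₁ : Xt *ᵥ (oraclePair βs θs b u v).1 =
      colsub Xt (ItSet βs θs) *ᵥ u + XtilT Xt βs θs *ᵥ b :=
    mulVec_assemble Xt βs _ _ (TtSet βs θs) (fun _ i e => mem_TtSet_of_eq βs θs i e) b u
  have e₂ : Xs *ᵥ (oraclePair βs θs b u v).2 =
      colsub Xs (IsSet βs θs) *ᵥ v + XtilS Xs βs θs *ᵥ b :=
    mulVec_assemble Xs θs _ _ (TsSet βs θs) (fun _ i e => mem_TsSet_of_eq βs θs i e) b v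
  simp only [obj, pooledLoss, e₁, e₂, inv_pow, Real.sq_sqrt (Nat.cast_nonneg _)]

end Oracle

theorem oracle_target_specific_component {nt ns dt ds : ℕ} (hnt : 0 < nt) (hns : 0 < ns)
    (Xt : Matrix (Fin nt) (Fin dt) ℝ) (Yt : Fin nt → ℝ)
    (Xs : Matrix (Fin ns) (Fin ds) ℝ) (Ys : Fin ns → ℝ)
    (βs : Fin dt → ℝ) (θs : Fin ds → ℝ)
    -- `A_t^c ≠ ∅`
    (hAtc : ∃ j, βs j = 0)
    -- `X^(t)_{I_t}` and `X^(s)_{I_s}` have full column rank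
    (hIt : IsUnit ((colsub Xt (ItSet βs θs))ᵀ * colsub Xt (ItSet βs θs)).det)
    (hIs : IsUnit ((colsub Xs (IsSet βs θs))ᵀ * colsub Xs (IsSet βs θs)).det)
    -- the pooled projected design `X̃_{T̃_t}` has full column rank
    (hXp : IsUnit ((Xpool Xt Xs βs θs)ᵀ * Xpool Xt Xs βs θs).det) :
    (∃! p : (Fin dt → ℝ) × (Fin ds → ℝ), isOracleMin Xt Yt Xs Ys βs θs p) ∧
    ∀ p : (Fin dt → ℝ) × (Fin ds → ℝ), isOracleMin Xt Yt Xs Ys βs θs p →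
      (∀ j : {j // j ∈ ItSet βs θs},
        p.1 j.1 =
          (((colsub Xt (ItSet βs θs))ᵀ * colsub Xt (ItSet βs θs))⁻¹ *ᵥ
            ((colsub Xt (ItSet βs θs))ᵀ *ᵥ
              (Yt - XtilT Xt βs θs *ᵥ betaHatTtil Xt Yt Xs Ys βs θs))) j) ∧
      (∀ j, βs j = 0 → p.1 j = 0) := by
  set b := betaHatTtil Xt Yt Xs Ys βs θs with hb
  set A₁ := colsub Xt (ItSet βs θs)
  set A₂ := colsub Xs (IsSet βs θs)
  set u := lsCoef A₁ (Yt - XtilT Xt βs θs *ᵥ b)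
  set v := lsCoef A₂ (Ys - XtilS Xs βs θs *ᵥ b)
  have hs₁ : (Real.sqrt nt)⁻¹ ≠ 0 := by positivity
  have hs₂ : (Real.sqrt ns)⁻¹ ≠ 0 := by positivity
  have hmin : isOracleMin Xt Yt Xs Ys βs θs (oraclePair βs θs b u v) := by
    refine ⟨feas_oraclePair βs θs b u v, fun q hq => ?_⟩
    obtain ⟨b', u', v', rfl⟩ := exists_eq_oraclePair βs θs hAtc hq
    rw [obj_oraclePair, obj_oraclePair]
    exact pooledLoss_min_le _ _ A₁ A₂ _ _ Yt Ys hIt hIs hXp b hb b' u' v'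
  have huniq : ∀ p, isOracleMin Xt Yt Xs Ys βs θs p → p = oraclePair βs θs b u v := by
    intro p hp
    have hle := hp.2 _ hmin.1
    obtain ⟨b', u', v', rfl⟩ := exists_eq_oraclePair βs θs hAtc hp.1
    rw [obj_oraclePair, obj_oraclePair] at hle
    obtain ⟨h₁, h₂, h₃⟩ := eq_of_pooledLoss_le _ _ A₁ A₂ _ _ Yt Ys hIt hIs hXp b hb hs₁ hs₂
      b' u' v' hle
    rw [h₁, h₂, h₃]
  refine ⟨⟨_, hmin, huniq⟩, fun p hp => ⟨fun j => ?_, hp.1.1⟩⟩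
  rw [huniq p hp]
  exact oraclePair_fst_apply βs θs b u v j

end CSTL3
end
end

section
/- Let a > 2, λ₁ > 0, β* ∈ ℝ^{d_t}, θ* ∈ ℝ^{d_s}, and let B = {(j,l) ∈ [d_t]×[d_s] : β*_j = θ*_l}. Let β̂_init ∈ ℝ^{d_t} and θ̂_init ∈ ℝ^{d_s} satisfy max_{(j,l)∈[d_t]×[d_s]} |(β̂_init,j − θ̂_init,l) − (β*_j − θ*_l)| ≤ λ₁/2. If min_{(j,l)∈B^c}|β*_j − θ*_l| ≥ (3a/2)λ₁, then the data-driven pairwise weights ŵ_{j,l} = (1/λ₁)·p′_{λ₁}(|β̂_init,j − θ̂_init,l|) recover the ideal weights exactly: ŵ_{j,l} = 1 for every (j,l) ∈ B and ŵ_{j,l} = 0 for every (j,l) ∈ B^c. -/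
/-!
Statement 14: the SCAD-derivative data-driven pairwise weights recover the
ideal fusion weights exactly.
-/

noncomputable section

namespace CSTL14

/-- Derivative of the SCAD penalty, `p′_λ(t)` for a nonnegative argument `t`
(the weights are always evaluated at `t = |·| ≥ 0`; as in the paper's
Figure 2, `p′_λ(t) = λ` on `[0, λ]`, decreases linearly to `0` on
`(λ, aλ]`, and vanishes for `t > aλ`). -/
def scadDeriv (a lam t : ℝ) : ℝ :=
  if t ≤ lam then lam
  else if t ≤ a * lam then (a * lam - t) / (a - 1)
  else 0

theorem scadDeriv_of_le {a lam t : ℝ} (h : t ≤ lam) : scadDeriv a lam t = lam :=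
  if_pos h

theorem scadDeriv_of_lt {a lam t : ℝ} (h : lam < t) (h' : a * lam < t) :
    scadDeriv a lam t = 0 := by
  rw [scadDeriv, if_neg h.not_ge, if_neg h'.not_ge]

theorem scad_weights_recover_ideal_fusion_weights
    {dt ds : ℕ} (a lam1 : ℝ) (ha : 2 < a) (hlam1 : 0 < lam1)
    (βs : Fin dt → ℝ) (θs : Fin ds → ℝ)
    (βinit : Fin dt → ℝ) (θinit : Fin ds → ℝ)
    -- `max_{(j,l)} |(β̂_init,j − θ̂_init,l) − (β*_j − θ*_l)| ≤ λ₁/2`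
    (hinit : ∀ (j : Fin dt) (l : Fin ds),
      |(βinit j - θinit l) - (βs j - θs l)| ≤ lam1 / 2)
    -- minimum separation: `min_{(j,l) ∈ B^c} |β*_j − θ*_l| ≥ (3a/2)λ₁`
    (hsignal : ∀ (j : Fin dt) (l : Fin ds), βs j ≠ θs l →
      3 * a / 2 * lam1 ≤ |βs j - θs l|) :
    (∀ (j : Fin dt) (l : Fin ds), βs j = θs l →
      (1 / lam1) * scadDeriv a lam1 |βinit j - θinit l| = 1) ∧
    (∀ (j : Fin dt) (l : Fin ds), βs j ≠ θs l →
      (1 / lam1) * scadDeriv a lam1 |βinit j - θinit l| = 0) := by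
  refine ⟨fun j l h => ?_, fun j l h => ?_⟩
  · have hle : |βinit j - θinit l| ≤ lam1 := by
      have := hinit j l
      rw [h, sub_self, sub_zero] at this
      linarith
    rw [scadDeriv_of_le hle, one_div_mul_cancel hlam1.ne']
  · have htri := abs_sub_abs_le_abs_sub (βs j - θs l) (βinit j - θinit l)
    rw [abs_sub_comm (βs j - θs l) (βinit j - θinit l)] at htri
    have hmul : 2 * lam1 < a * lam1 := mul_lt_mul_of_pos_right ha hlam1
    have hlt : a * lam1 < |βinit j - θinit l| := by
      linarith [hinit j l, hsignal j l h]
    rw [scadDeriv_of_lt (by linarith) hlt, mul_zero]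

end CSTL14
end
end
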